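/- arXiv:1502.01462 — 7 statements merged into one kernel-verified Lean document; each statement's English description precedes it below -/
import Mathlib

section
/- Let (Pyes, Pno) be a unary promise problem. Suppose there is a Moore–Crutchfield quantum finite automaton over the one-letter alphabet, i.e. a number of states q, a unitary matrix U ∈ Matrix.unitaryGroup (Fin q) ℂ, an initial vector v₀ ∈ ℂ^q of norm 1, and a set Qa ⊆ Fin q, whose acceptance probability f(m) = Σ_{j ∈ Qa} ‖(U^m v₀)(j)‖² satisfies f(m) = 1 for every m ∈ Pyes and f(m) = 0 for every m ∈ Pno (i.e. the QFA solves the problem exactly). Then there exist a finite state type σ and a DFA over the one-letter alphabet (alphabet Unit) that solves the promise problem: for every m ∈ Pyes the word of length m is in its accepted language, and for every m ∈ Pno it is not. -/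
theorem Int.isJacobsonRing : IsJacobsonRing ℤ := by
  rw [isJacobsonRing_iff_prime_eq]
  intro P hP
  rcases eq_or_ne P ⊥ with rfl | hne
  · rw [eq_bot_iff]
    intro x hx
    rw [Ideal.mem_jacobson_bot] at hx
    have h := Int.isUnit_iff.mp (hx (3 * x))
    rw [Ideal.mem_bot]
    rcases h with h | h <;> nlinarith [sq_nonneg x]
  · have := hP.isMaximal hne
    exact Ideal.jacobson_eq_self_of_isMaximal

/-- A field which is finitely generated as a ring is finite. -/
theorem Field.finite_of_finiteType_int (K : Type*) [Field K] [Algebra.FiniteType ℤ K] :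
    Finite K := by
  have := Int.isJacobsonRing
  have hfin : Module.Finite ℤ K := finite_of_finite_type_of_isJacobsonRing ℤ K
  have hninj : ¬ Function.Injective (algebraMap ℤ K) := fun hinj =>
    Int.not_isField (isField_of_isIntegral_of_isField hinj (Field.toIsField K))
  obtain ⟨n, hn, hn0⟩ : ∃ n : ℤ, algebraMap ℤ K n = 0 ∧ n ≠ 0 := by
    rw [injective_iff_map_eq_zero] at hninj
    push Not at hninj
    exact hninj
  refine Module.finite_of_fg_torsion K fun {x} => ⟨⟨n, mem_nonZeroDivisors_of_ne_zero hn0⟩, ?_⟩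
  rw [Submonoid.mk_smul, Algebra.smul_def, hn, zero_mul]

/-- A nontrivial finitely generated commutative ring has a finite residue field. -/
theorem exists_isMaximal_finite_quotient (R : Type*) [CommRing R] [Nontrivial R]
    [Algebra.FiniteType ℤ R] : ∃ I : Ideal R, I.IsMaximal ∧ Finite (R ⧸ I) := by
  obtain ⟨I, hI⟩ := Ideal.exists_maximal R
  have hft : Algebra.FiniteType ℤ (R ⧸ I) :=
    .of_surjective (Ideal.Quotient.mk I).toIntAlgHom Ideal.Quotient.mk_surjective
  exact ⟨I, hI, @Field.finite_of_finiteType_int (R ⧸ I) (Ideal.Quotient.field I) hft⟩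

/-- The unary automaton iterating `f` from `s` and accepting the states satisfying `p`. -/
def DFA.iterate {σ : Type*} (f : σ → σ) (s : σ) (p : σ → Prop) : DFA Unit σ where
  step x _ := f x
  start := s
  accept := {x | p x}

theorem DFA.replicate_mem_accepts_iterate {σ : Type*} (f : σ → σ) (s : σ) (p : σ → Prop)
    (m : ℕ) : List.replicate m () ∈ (DFA.iterate f s p).accepts ↔ p (f^[m] s) := by
  have h (x : σ) : (DFA.iterate f s p).evalFrom x (List.replicate m ()) = f^[m] x := by
    induction m generalizing x with
    | zero => rfl
    | succ m ih => exact ih (f x)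
  rw [DFA.mem_accepts, DFA.eval, h]
  rfl

theorem Matrix.iterate_mulVec {n R : Type*} [Fintype n] [DecidableEq n] [CommRing R]
    (A : Matrix n n R) (v : n → R) (m : ℕ) : A.mulVec^[m] v = (A ^ m).mulVec v := by
  induction m with
  | zero => simp
  | succ m ih => rw [Function.iterate_succ_apply', ih, Matrix.mulVec_mulVec, pow_succ']

/-- The sum over `s` of the products of the coordinates of `A ^ m * v` and `B ^ m * w`. -/
def Matrix.powPairing {n R : Type*} [Fintype n] [DecidableEq n] [CommRing R] (s : Finset n)
    (A B : Matrix n n R) (v w : n → R) (m : ℕ) : R :=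
  ∑ j ∈ s, (A ^ m).mulVec v j * (B ^ m).mulVec w j

theorem Matrix.map_powPairing {n R S : Type*} [Fintype n] [DecidableEq n] [CommRing R]
    [CommRing S] (φ : R →+* S) (s : Finset n) (A B : Matrix n n R) (v w : n → R) (m : ℕ) :
    φ (Matrix.powPairing s A B v w m) =
      Matrix.powPairing s (A.map φ) (B.map φ) (φ ∘ v) (φ ∘ w) m := by
  simp only [Matrix.powPairing, map_sum, map_mul, RingHom.map_mulVec, Matrix.map_pow]

/-- The level sets over `1` and over `0` of a sequence `m ↦ powPairing s A B v w m` are separated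
by a regular language. -/
theorem Matrix.exists_dfa_powPairing {n R : Type} [Fintype n] [DecidableEq n] [CommRing R]
    [Nontrivial R] (s : Finset n) (A B : Matrix n n R) (v w : n → R) :
    ∃ (σ : Type) (_ : Fintype σ) (M : DFA Unit σ), ∀ m,
      (Matrix.powPairing s A B v w m = 1 → List.replicate m () ∈ M.accepts) ∧
      (Matrix.powPairing s A B v w m = 0 → List.replicate m () ∉ M.accepts) := by
  let S : Set R := Set.range (fun i : n × n => A i.1 i.2) ∪
    Set.range (fun i : n × n => B i.1 i.2) ∪ Set.range v ∪ Set.range w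
  have hS : S.Finite := (((Set.finite_range _).union (Set.finite_range _)).union
    (Set.finite_range _)).union (Set.finite_range _)
  let T := Algebra.adjoin ℤ S
  have hmem {x : R} (hx : x ∈ S) : x ∈ T := Algebra.subset_adjoin hx
  have : Algebra.FiniteType ℤ T := .adjoin_of_finite hS
  let A' : Matrix n n T := .of fun i j => ⟨A i j, hmem (.inl (.inl (.inl ⟨(i, j), rfl⟩)))⟩
  let B' : Matrix n n T := .of fun i j => ⟨B i j, hmem (.inl (.inl (.inr ⟨(i, j), rfl⟩)))⟩
  let v' : n → T := fun i => ⟨v i, hmem (.inl (.inr ⟨i, rfl⟩))⟩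
  let w' : n → T := fun i => ⟨w i, hmem (.inr ⟨i, rfl⟩)⟩
  have hcoe (m : ℕ) : ((Matrix.powPairing s A' B' v' w' m : T) : R) =
      Matrix.powPairing s A B v w m := Matrix.map_powPairing T.val.toRingHom s A' B' v' w' m
  obtain ⟨I, hI, hfin⟩ := exists_isMaximal_finite_quotient T
  let φ := Ideal.Quotient.mk I
  have hmap := Matrix.map_powPairing φ s A' B' v' w'
  refine ⟨(n → T ⧸ I) × (n → T ⧸ I), Fintype.ofFinite _,
    DFA.iterate (Prod.map (A'.map φ).mulVec (B'.map φ).mulVec) (φ ∘ v', φ ∘ w')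
      (fun x => ∑ j ∈ s, x.1 j * x.2 j = 1), fun m => ?_⟩
  rw [DFA.replicate_mem_accepts_iterate, Prod.map_iterate, Prod.map_apply,
    Matrix.iterate_mulVec, Matrix.iterate_mulVec]
  change (_ → Matrix.powPairing s (A'.map φ) (B'.map φ) (φ ∘ v') (φ ∘ w') m = 1) ∧
    (_ → ¬ Matrix.powPairing s (A'.map φ) (B'.map φ) (φ ∘ v') (φ ∘ w') m = 1)
  rw [← hmap, ← hcoe]
  constructor
  · intro h
    rw [OneMemClass.coe_eq_one.mp h, map_one]
  · intro h
    rw [ZeroMemClass.coe_eq_zero.mp h, map_zero]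
    exact zero_ne_one

theorem Matrix.sum_norm_sq_eq_powPairing {n : Type*} [Fintype n] [DecidableEq n]
    (s : Finset n) (A : Matrix n n ℂ) (v : n → ℂ) (m : ℕ) :
    ((∑ j ∈ s, ‖(A ^ m).mulVec v j‖ ^ 2 : ℝ) : ℂ) =
      Matrix.powPairing s A (A.map (starRingEnd ℂ)) v (starRingEnd ℂ ∘ v) m := by
  simp only [Matrix.powPairing, ← Matrix.map_pow, ← RingHom.map_mulVec, Complex.mul_conj']
  push_cast
  rfl

/-- A unary promise problem `(Pyes, Pno)` (disjoint subsets of `ℕ`) solved exactly by a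
Moore–Crutchfield QFA over a one-letter alphabet is also solved by a DFA over the
one-letter alphabet. -/
theorem unary_exact_qfa_implies_dfa
    (Pyes Pno : Set ℕ) (hdisj : Disjoint Pyes Pno)
    (q : ℕ) (U : Matrix.unitaryGroup (Fin q) ℂ)
    (v₀ : Fin q → ℂ) (hv : ∑ j, ‖v₀ j‖ ^ 2 = 1)
    (Qa : Finset (Fin q))
    (hyes : ∀ m ∈ Pyes,
      ∑ j ∈ Qa, ‖((U : Matrix (Fin q) (Fin q) ℂ) ^ m).mulVec v₀ j‖ ^ 2 = 1)
    (hno : ∀ m ∈ Pno,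
      ∑ j ∈ Qa, ‖((U : Matrix (Fin q) (Fin q) ℂ) ^ m).mulVec v₀ j‖ ^ 2 = 0) :
    ∃ (σ : Type) (_ : Fintype σ) (M : DFA Unit σ),
      (∀ m ∈ Pyes, List.replicate m () ∈ M.accepts) ∧
      (∀ m ∈ Pno, List.replicate m () ∉ M.accepts) := by
  obtain ⟨σ, hσ, M, hM⟩ := Matrix.exists_dfa_powPairing Qa (U : Matrix (Fin q) (Fin q) ℂ)
    ((U : Matrix (Fin q) (Fin q) ℂ).map (starRingEnd ℂ)) v₀ (starRingEnd ℂ ∘ v₀)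
  refine ⟨σ, hσ, M, fun m hm => (hM m).1 ?_, fun m hm => (hM m).2 ?_⟩
  · rw [← Matrix.sum_norm_sq_eq_powPairing, hyes m hm, Complex.ofReal_one]
  · rw [← Matrix.sum_norm_sq_eq_powPairing, hno m hm, Complex.ofReal_zero]
end

section
/- Let (Pyes, Pno) be a unary promise problem. Suppose there is a Las Vegas MCQFA over the one-letter alphabet: a number of states q, a unitary matrix U ∈ Matrix.unitaryGroup (Fin q) ℂ, an initial unit vector v₀ ∈ ℂ^q, two disjoint sets Qa, Qr ⊆ Fin q (accepting and rejecting states), and a success probability p > 0 such that, writing acc(m) = Σ_{j ∈ Qa} ‖(U^m v₀)(j)‖² and rej(m) = Σ_{j ∈ Qr} ‖(U^m v₀)(j)‖², one has acc(m) ≥ p and rej(m) = 0 for every m ∈ Pyes, and rej(m) ≥ p and acc(m) = 0 for every m ∈ Pno. Then there exist a finite state type σ and a DFA over the one-letter alphabet that solves the promise problem. -/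
/-- The sum `∑ j, k (k - 1) ⋯ (k - j + 1) * a j`, whose terms vanish for `j > k`. -/
def fallingSum {R : Type*} [CommRing R] (a : ℕ → R) (k : ℕ) : R :=
  ∑ j ∈ Finset.range (k + 1), (k.descFactorial j : R) * a j

section FallingSum
variable {R : Type*} [CommRing R]

lemma fallingSum_zero (a : ℕ → R) : fallingSum a 0 = a 0 := by simp [fallingSum]

lemma fallingSum_succ (a : ℕ → R) (k : ℕ) :
    fallingSum a (k + 1) = a 0 + (k + 1) * fallingSum (fun j => a (j + 1)) k := by
  rw [fallingSum, Finset.sum_range_succ', fallingSum, Finset.mul_sum, add_comm]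
  simp only [Nat.succ_descFactorial_succ]
  simp [mul_assoc]

lemma fallingSum_add (a b : ℕ → R) (k : ℕ) :
    fallingSum (fun j => a j + b j) k = fallingSum a k + fallingSum b k := by
  simp [fallingSum, mul_add, Finset.sum_add_distrib]

lemma fallingSum_shift (a : ℕ → R) (k : ℕ) :
    fallingSum a (k + 1) = fallingSum (fun j => a j + (j + 1) * a (j + 1)) k := by
  induction k generalizing a with
  | zero => simp [fallingSum_succ, fallingSum_zero]
  | succ k ih =>
    have h : (fun j => a (j + 1) + ((j + 1 : ℕ) + 1) * a (j + 1 + 1)) =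
        fun j => (a (j + 1) + (j + 1) * a (j + 1 + 1)) + a (j + 1 + 1) := by
      funext j; push_cast; ring
    rw [fallingSum_succ, fallingSum_succ (fun j => a j + (j + 1) * a (j + 1)), h,
      fallingSum_add, ← ih (fun j => a (j + 1)), fallingSum_succ (fun j => a (j + 1))]
    push_cast
    ring

lemma eventually_dvd_fallingSum [IsDomain R] [CharZero R] (P : R) (n : ℕ) (a : ℕ → R)
    (ha : ∀ j, n ≤ j → P ∣ a j) (hz : {k | fallingSum a k = 0}.Infinite) :
    ∃ K, ∀ k, K ≤ k → P ∣ fallingSum a k := by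
  induction n generalizing a with
  | zero =>
    exact ⟨0, fun k _ => Finset.dvd_sum fun j _ => (ha j (Nat.zero_le j)).mul_left _⟩
  | succ n ih =>
    obtain ⟨k₀, hk₀⟩ := hz.nonempty
    rw [Set.mem_ofPred_eq] at hk₀
    induction k₀ generalizing a with
    | zero =>
      rw [fallingSum_zero] at hk₀
      have hs (k : ℕ) :
          fallingSum a (k + 1) = (k + 1) * fallingSum (fun j => a (j + 1)) k := by
        rw [fallingSum_succ, hk₀, zero_add]
      obtain ⟨K, hK⟩ := ih (fun j => a (j + 1)) (fun j hj => ha _ (by omega)) (by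
        refine fun hfin => hz (((hfin.image Nat.succ).insert 0).subset ?_)
        rintro (_ | k) hk
        · exact Set.mem_insert _ _
        · refine Set.mem_insert_of_mem _ ⟨k, ?_, rfl⟩
          rw [Set.mem_ofPred_eq, hs] at hk
          exact (mul_eq_zero.mp hk).resolve_left (by exact_mod_cast k.succ_ne_zero))
      refine ⟨K + 1, fun k hk => ?_⟩
      obtain ⟨k, rfl⟩ : ∃ l, k = l + 1 := ⟨k - 1, by omega⟩
      rw [hs]
      exact (hK k (by omega)).mul_left _
    | succ k₀ ih' =>
      rw [fallingSum_shift] at hk₀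
      obtain ⟨K, hK⟩ := ih' (fun j => a j + (j + 1) * a (j + 1))
        (fun j hj => dvd_add (ha j hj) ((ha _ (by omega)).mul_left _)) (by
          refine fun hfin => hz (((hfin.image Nat.succ).insert 0).subset ?_)
          rintro (_ | k) hk
          · exact Set.mem_insert _ _
          · refine Set.mem_insert_of_mem _ ⟨k, ?_, rfl⟩
            rwa [Set.mem_ofPred_eq, fallingSum_shift] at hk) hk₀
      refine ⟨K + 1, fun k hk => ?_⟩
      obtain ⟨k, rfl⟩ : ∃ l, k = l + 1 := ⟨k - 1, by omega⟩
      rw [fallingSum_shift]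
      exact hK k (by omega)

lemma fallingSum_eq_sum_range (a : ℕ → R) {k n : ℕ} (h : k < n) :
    fallingSum a k = ∑ j ∈ Finset.range n, (k.descFactorial j : R) * a j := by
  refine Finset.sum_subset (Finset.range_subset_range.mpr h) fun j _ hj => ?_
  rw [Nat.descFactorial_of_lt (by simpa using hj)]
  simp

lemma dvd_fallingSum_add_sub (a : ℕ → R) (k q : ℕ) :
    (q : R) ∣ fallingSum a (k + q) - fallingSum a k := by
  rw [fallingSum_eq_sum_range a (Nat.lt_succ_self (k + q)),
    fallingSum_eq_sum_range a (show k < k + q + 1 by omega), ← Finset.sum_sub_distrib]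
  refine Finset.dvd_sum fun j _ => ?_
  rw [← sub_mul, ← descPochhammer_eval_eq_descFactorial, ← descPochhammer_eval_eq_descFactorial]
  refine Dvd.dvd.mul_right ?_ _
  simpa using Polynomial.sub_dvd_eval_sub ((k + q : ℕ) : R) (k : R) (descPochhammer R j)

end FallingSum

lemma PadicInt.eq_zero_of_forall_pow_dvd {p : ℕ} [Fact p.Prime] {x : ℤ_[p]}
    (h : ∀ M : ℕ, (p : ℤ_[p]) ^ M ∣ x) : x = 0 := by
  by_contra hx
  have := (PadicInt.mem_span_pow_iff_le_valuation x hx (x.valuation + 1)).mp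
    (Ideal.mem_span_singleton.mpr (h _))
  omega

lemma fallingSum_eq_zero_of_infinite {p : ℕ} [Fact p.Prime] (a : ℕ → ℤ_[p])
    (ha : ∀ M : ℕ, ∃ n, ∀ j, n ≤ j → (p : ℤ_[p]) ^ M ∣ a j)
    (hz : {k | fallingSum a k = 0}.Infinite) (k : ℕ) : fallingSum a k = 0 := by
  refine PadicInt.eq_zero_of_forall_pow_dvd fun M => ?_
  obtain ⟨n, hn⟩ := ha M
  obtain ⟨K, hK⟩ := eventually_dvd_fallingSum _ n a hn hz
  have h1 := hK (k + p ^ M * K)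
    (le_add_left (Nat.le_mul_of_pos_left K (pow_pos (Fact.out : p.Prime).pos M)))
  have h2 := dvd_fallingSum_add_sub a k (p ^ M * K)
  rw [Nat.cast_mul, Nat.cast_pow] at h2
  simpa using dvd_sub h1 ((dvd_mul_right _ _).trans h2)

lemma PadicInt.exists_factorial_mul_eq_pow {p : ℕ} [Fact p.Prime] (hp : 2 < p) (j : ℕ) :
    ∃ c : ℤ_[p], (j.factorial : ℤ_[p]) * (p ^ (j / 2) * c) = (p : ℤ_[p]) ^ j := by
  have hp' : p.Prime := Fact.out
  obtain ⟨m, hm, hpm⟩ : ∃ m, j.factorial = p ^ padicValNat p j.factorial * m ∧ ¬ p ∣ m := by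
    have := Nat.exists_eq_pow_mul_and_not_dvd j.factorial_ne_zero p hp'.ne_one
    obtain ⟨e, m, hm, h⟩ := this
    refine ⟨m, ?_, hm⟩
    rw [h, padicValNat.mul (pow_ne_zero _ hp'.ne_zero) (by rintro rfl; simp at hm),
      padicValNat.prime_pow, padicValNat.eq_zero_of_not_dvd hm, add_zero]
  have hv : 2 * padicValNat p j.factorial ≤ j := by
    have h1 := sub_one_mul_padicValNat_factorial (p := p) j
    have h2 : 2 * padicValNat p j.factorial ≤ (p - 1) * padicValNat p j.factorial :=
      Nat.mul_le_mul_right _ (by omega)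
    omega
  have hu : IsUnit (m : ℤ_[p]) := by
    rw [PadicInt.isUnit_iff]
    exact PadicInt.norm_natCast_eq_one_iff.mpr ((Nat.Prime.coprime_iff_not_dvd hp').mpr hpm)
  obtain ⟨u, hu⟩ := hu
  generalize padicValNat p j.factorial = e at hm hv
  refine ⟨p ^ (j - e - j / 2) * ↑u⁻¹, ?_⟩
  have he : j = e + j / 2 + (j - e - j / 2) := by
    omega
  conv_lhs => rw [hm]
  conv_rhs => rw [he]
  push_cast
  rw [← hu, pow_add, pow_add]
  linear_combination ((p : ℤ_[p]) ^ e * p ^ (j / 2) *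
    p ^ (j - e - j / 2)) * u.mul_inv

lemma sum_choose_mul_pow_eq_zero_of_infinite {p : ℕ} [Fact p.Prime] (hp : 2 < p) (d : ℕ → ℤ)
    (hz : {k | ∑ j ∈ Finset.range (k + 1), (k.choose j : ℤ) * (p ^ j * d j) = 0}.Infinite)
    (k : ℕ) : ∑ j ∈ Finset.range (k + 1), (k.choose j : ℤ) * (p ^ j * d j) = 0 := by
  choose c hc using PadicInt.exists_factorial_mul_eq_pow (p := p) hp
  have key (k : ℕ) : fallingSum (fun j => (p : ℤ_[p]) ^ (j / 2) * c j * (d j : ℤ_[p])) k =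
      ((∑ j ∈ Finset.range (k + 1), (k.choose j : ℤ) * (p ^ j * d j) : ℤ) : ℤ_[p]) := by
    rw [fallingSum]
    push_cast
    refine Finset.sum_congr rfl fun j _ => ?_
    rw [Nat.descFactorial_eq_factorial_mul_choose, ← hc j]
    push_cast
    ring
  have := fallingSum_eq_zero_of_infinite (fun j => (p : ℤ_[p]) ^ (j / 2) * c j * (d j : ℤ_[p]))
    (fun M => ⟨2 * M, fun j hj => ((pow_dvd_pow _ (by omega)).mul_right _).mul_right _⟩)
    (by simpa only [key, Int.cast_eq_zero] using hz) k
  rwa [key, Int.cast_eq_zero] at this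


lemma Matrix.one_add_smul_pow_mul_apply {n : Type*} [Fintype n] [DecidableEq n]
    (C B V : Matrix n n ℤ) (p : ℤ) (k : ℕ) (i j : n) :
    (C * (1 + p • B) ^ k * V) i j =
      ∑ l ∈ Finset.range (k + 1), (k.choose l : ℤ) * (p ^ l * (C * B ^ l * V) i j) := by
  rw [add_comm, (Commute.one_right (p • B)).add_pow, Finset.mul_sum, Finset.sum_mul,
    Matrix.sum_apply]
  refine Finset.sum_congr rfl fun l _ => ?_
  have : C * ((p • B) ^ l * 1 ^ (k - l) * (k.choose l : Matrix n n ℤ)) * V =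
      ((k.choose l : ℤ) * p ^ l) • (C * B ^ l * V) := by
    rw [one_pow, mul_one, smul_pow, ← nsmul_eq_mul', mul_smul_comm, mul_smul_comm,
      smul_mul_assoc, smul_mul_assoc, mul_smul, Nat.cast_smul_eq_nsmul]
  rw [this, Matrix.smul_apply, smul_eq_mul, mul_assoc]

lemma Matrix.pow_mul_apply_eq_zero_of_infinite {n : Type*} [Fintype n] [DecidableEq n]
    {p : ℕ} [Fact p.Prime] (hp : 2 < p) {A B : Matrix n n ℤ} (V : Matrix n n ℤ) {N : ℕ}
    (hA : A ^ N = 1 + (p : ℤ) • B) (r : ℕ) (i j : n)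
    (hz : {k | (A ^ (r + N * k) * V) i j = 0}.Infinite) (k : ℕ) :
    (A ^ (r + N * k) * V) i j = 0 := by
  simp only [pow_add, pow_mul, hA, Matrix.one_add_smul_pow_mul_apply] at hz ⊢
  exact sum_choose_mul_pow_eq_zero_of_infinite hp _ hz k

/-- A form of the Skolem–Mahler–Lech property: the entries of `A ^ m * V`, for `A` of nonzero
determinant, vanish only finitely often or identically on each class of a common modulus. -/
def SkolemMahlerLech (R : Type*) [CommRing R] : Prop :=
  ∀ (n : Type) [Fintype n] [DecidableEq n] (A V : Matrix n n R), A.det ≠ 0 →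
    ∃ N, 0 < N ∧ ∀ r i j, {k | (A ^ (r + N * k) * V) i j = 0}.Infinite →
      ∀ k, (A ^ (r + N * k) * V) i j = 0

lemma MvPolynomial.intCast_eval_eq {σ : Type*} {p : ℕ} {x y : σ → ℤ}
    (h : ∀ s, (p : ℤ) ∣ y s - x s) (P : MvPolynomial σ ℤ) :
    ((eval y P : ℤ) : ZMod p) = (eval x P : ℤ) := by
  have : (Int.castRingHom (ZMod p)).comp (eval y) = (Int.castRingHom (ZMod p)).comp (eval x) := by
    refine MvPolynomial.ringHom_ext (fun r => by simp) fun s => ?_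
    simpa using ((ZMod.intCast_eq_intCast_iff_dvd_sub _ _ _).mpr (h s)).symm
  exact congrArg (fun f => f P) this

lemma Matrix.exists_eq_one_add_smul {n : Type*} [DecidableEq n] {p : ℕ} {A : Matrix n n ℤ}
    (h : A.map (Int.castRingHom (ZMod p)) = 1) : ∃ B, A = 1 + (p : ℤ) • B := by
  have hd (i j) : (p : ℤ) ∣ (A - 1) i j := by
    rw [← ZMod.intCast_zmod_eq_zero_iff_dvd]
    have := congrFun (congrFun h i) j
    rw [Matrix.map_apply] at this
    by_cases hij : i = j
    · subst hij; simpa [sub_eq_zero] using this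
    · simpa [hij] using this
  choose B hB using hd
  refine ⟨Matrix.of B, ?_⟩
  ext i j
  have := hB i j
  simp only [Matrix.sub_apply, Matrix.add_apply, Matrix.smul_apply, Matrix.of_apply,
    smul_eq_mul] at this ⊢
  linarith

lemma skolemMahlerLech_mvPolynomial_int (σ : Type*) : SkolemMahlerLech (MvPolynomial σ ℤ) := by
  intro n _ _ A V hA
  obtain ⟨x, hx⟩ : ∃ x, MvPolynomial.eval x A.det ≠ 0 := by
    by_contra! h
    exact hA (MvPolynomial.funext fun x => by simpa using h x)
  obtain ⟨p, hpge, hp⟩ :=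
    Nat.exists_infinite_primes ((MvPolynomial.eval x A.det).natAbs + 3)
  have : Fact p.Prime := ⟨hp⟩
  let f (y : σ → ℤ) : Matrix n n (MvPolynomial σ ℤ) →+* Matrix n n ℤ :=
    (MvPolynomial.eval y).mapMatrix
  let c : Matrix n n ℤ →+* Matrix n n (ZMod p) := (Int.castRingHom (ZMod p)).mapMatrix
  have hu : IsUnit (c (f x A)) := by
    rw [Matrix.isUnit_iff_isUnit_det, isUnit_iff_ne_zero, ← RingHom.map_det, ← RingHom.map_det,
      eq_intCast, Ne, ZMod.intCast_zmod_eq_zero_iff_dvd]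
    intro h
    have := Nat.le_of_dvd (Int.natAbs_pos.mpr hx) (Int.natCast_dvd.mp h)
    omega
  obtain ⟨u, hu⟩ := hu
  refine ⟨orderOf u, orderOf_pos u, fun r i j hz k => ?_⟩
  refine MvPolynomial.funext_set (fun s => Set.range fun z : ℤ => x s + p * z)
    (fun s => Set.infinite_range_of_injective fun z w h => ?_) fun y hy => ?_
  · simpa [hp.ne_zero] using h
  · have hxy (s : σ) : (p : ℤ) ∣ y s - x s := by
      obtain ⟨z, hz⟩ := hy s (Set.mem_univ s)
      exact ⟨z, by rw [← hz]; ring⟩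
    have hc : c (f y A) = c (f x A) := by
      ext i j
      exact MvPolynomial.intCast_eval_eq hxy (A i j)
    obtain ⟨B, hB⟩ := Matrix.exists_eq_one_add_smul (p := p) (A := f y A ^ orderOf u) (by
      change c _ = 1
      rw [map_pow, hc, ← hu, ← Units.val_pow_eq_pow_val, pow_orderOf_eq_one, Units.val_one])
    have hf (m : ℕ) : MvPolynomial.eval y ((A ^ m * V) i j) = (f y A ^ m * f y V) i j := by
      rw [← map_pow, ← map_mul]; rfl
    rw [map_zero, hf]
    refine Matrix.pow_mul_apply_eq_zero_of_infinite (by omega) (f y V) hB r i j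
      (hz.mono fun k hk => ?_) k
    rw [Set.mem_ofPred_eq] at hk ⊢
    rw [← hf, hk, map_zero]

lemma SkolemMahlerLech.of_isLocalization {R : Type*} [CommRing R] (hR : SkolemMahlerLech R)
    (M : Submonoid R) (hM : M ≤ nonZeroDivisors R) (S : Type*) [CommRing S] [Algebra R S]
    [IsLocalization M S] : SkolemMahlerLech S := by
  intro n _ _ A V hA
  obtain ⟨b, hb⟩ := IsLocalization.exist_integer_multiples_of_finite M
    (Sum.elim (fun ij : n × n => A ij.1 ij.2) fun ij : n × n => V ij.1 ij.2)
  choose g hg using hb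
  let A' : Matrix n n R := Matrix.of fun i j => g (Sum.inl (i, j))
  let V' : Matrix n n R := Matrix.of fun i j => g (Sum.inr (i, j))
  let f : Matrix n n R →+* Matrix n n S := (algebraMap R S).mapMatrix
  set β : S := algebraMap R S b with hβ
  have hu : IsUnit β := IsLocalization.map_units S b
  have hA' : f A' = β • A := by
    ext i j
    simpa [A', f, Algebra.smul_def, Submonoid.smul_def] using hg (Sum.inl (i, j))
  have hV' : f V' = β • V := by
    ext i j
    simpa [V', f, Algebra.smul_def, Submonoid.smul_def] using hg (Sum.inr (i, j))
  have hdet : A'.det ≠ 0 := by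
    intro h
    have h1 : (f A').det = 0 := by rw [← RingHom.map_det, h, map_zero]
    rw [hA', Matrix.det_smul] at h1
    exact hA ((hu.pow _).mul_right_eq_zero.mp h1)
  have key (m : ℕ) (i j : n) : (A' ^ m * V') i j = 0 ↔ (A ^ m * V) i j = 0 := by
    have h1 : algebraMap R S ((A' ^ m * V') i j) = β ^ (m + 1) * (A ^ m * V) i j := by
      have : f (A' ^ m * V') = β ^ (m + 1) • (A ^ m * V) := by
        rw [map_mul, map_pow, hA', hV', smul_pow, smul_mul_smul_comm, pow_succ]
      exact congrFun (congrFun this i) j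
    rw [← (IsLocalization.injective S hM).eq_iff, map_zero, h1, (hu.pow _).mul_right_eq_zero]
  obtain ⟨N, hN, h⟩ := hR n A' V' hdet
  exact ⟨N, hN, by simpa only [key] using h⟩

lemma SkolemMahlerLech.of_ringEquiv {R S : Type*} [CommRing R] [CommRing S]
    (hR : SkolemMahlerLech R) (e : R ≃+* S) : SkolemMahlerLech S := by
  let _ : Algebra R S := e.toRingHom.toAlgebra
  have : IsLocalization (⊥ : Submonoid R) R := IsLocalization.self bot_le
  have : IsLocalization (⊥ : Submonoid R) S :=
    IsLocalization.isLocalization_of_algEquiv ⊥ (AlgEquiv.ofRingEquiv (f := e) fun _ => rfl)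
  exact hR.of_isLocalization ⊥ bot_le S

lemma SkolemMahlerLech.of_finiteDimensional {E F : Type*} [Field E] [Field F] [Algebra E F]
    [FiniteDimensional E F] (hE : SkolemMahlerLech E) : SkolemMahlerLech F := by
  intro n _ _ A V hA
  let b := Module.finBasis E F
  let Φ : Matrix n n F →+* Matrix (n × Fin (Module.finrank E F)) (n × Fin (Module.finrank E F)) E :=
    (Matrix.compRingEquiv n (Fin (Module.finrank E F)) E).toRingHom.comp
      (Algebra.leftMulMatrix b).toRingHom.mapMatrix
  have hΦ (C : Matrix n n F) (i j : n) : C i j = 0 ↔ ∀ k l, Φ C (i, k) (j, l) = 0 := by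
    rw [← (Algebra.leftMulMatrix_injective b).eq_iff, map_zero, ← Matrix.ext_iff]
    rfl
  have hdet : (Φ A).det ≠ 0 := by
    have : IsUnit A := (Matrix.isUnit_iff_isUnit_det A).mpr hA.isUnit
    exact ((Matrix.isUnit_iff_isUnit_det _).mp (this.map Φ)).ne_zero
  obtain ⟨N, hN, h⟩ := hE _ (Φ A) (Φ V) hdet
  refine ⟨N, hN, fun r i j hz m => (hΦ _ i j).mpr fun k l => ?_⟩
  rw [map_mul, map_pow]
  refine h r _ _ (hz.mono fun m hm => ?_) m
  rw [Set.mem_ofPred_eq] at hm ⊢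
  rw [← map_pow, ← map_mul]
  exact (hΦ _ i j).mp hm k l

lemma skolemMahlerLech_fractionRing_mvPolynomial_rat (σ : Type*) :
    SkolemMahlerLech (FractionRing (MvPolynomial σ ℚ)) := by
  let _ : Algebra (MvPolynomial σ ℤ) (MvPolynomial σ ℚ) := MvPolynomial.algebraMvPolynomial
  let M : Submonoid (MvPolynomial σ ℤ) := (nonZeroDivisors ℤ).map MvPolynomial.C
  have hM : M ≤ nonZeroDivisors (MvPolynomial σ ℤ) := by
    rintro _ ⟨z, hz, rfl⟩
    exact mem_nonZeroDivisors_of_ne_zero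
      ((MvPolynomial.C_ne_zero).mpr (nonZeroDivisors.ne_zero hz))
  have : IsLocalization M (MvPolynomial σ ℚ) :=
    MvPolynomial.isLocalization (nonZeroDivisors ℤ) ℚ
  exact ((skolemMahlerLech_mvPolynomial_int σ).of_isLocalization M hM
    (MvPolynomial σ ℚ)).of_isLocalization _ le_rfl _

lemma SkolemMahlerLech.adjoin_range {σ F L : Type*} [Field F] [Field L] [Algebra F L]
    (h : SkolemMahlerLech (FractionRing (MvPolynomial σ F))) {x : σ → L}
    (hx : AlgebraicIndependent F x) :
    SkolemMahlerLech (IntermediateField.adjoin F (Set.range x)) :=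
  h.of_ringEquiv hx.aevalEquivField.toRingEquiv

lemma skolemMahlerLech_of_charZero (L : Type*) [Field L] [CharZero L] : SkolemMahlerLech L := by
  intro n _ _ A V hA
  let s : Set L := Set.range (fun ij : n × n => A ij.1 ij.2) ∪
    Set.range (fun ij : n × n => V ij.1 ij.2)
  have : Finite s := ((Set.finite_range _).union (Set.finite_range _)).to_subtype
  obtain ⟨t, -, ht⟩ := exists_maximal_algebraicIndependent (R := ℚ) (∅ : Set L) s
    (Set.empty_subset _) ((algebraicIndependent_empty_iff ℚ L).mpr (algebraMap ℚ L).injective)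
  have hind : AlgebraicIndependent ℚ ((↑) : t → L) := ht.prop.1
  let E := IntermediateField.adjoin ℚ (Set.range ((↑) : t → L))
  have hE : SkolemMahlerLech E :=
    (skolemMahlerLech_fractionRing_mvPolynomial_rat t).adjoin_range hind
  have hint (x : L) (hx : x ∈ s) : IsIntegral E x := by
    by_cases hxt : x ∈ t
    · exact isIntegral_algebraMap
        (x := (⟨x, IntermediateField.subset_adjoin _ _ ⟨⟨x, hxt⟩, rfl⟩⟩ : E))
    · have halg : IsAlgebraic (Algebra.adjoin ℚ (Set.range ((↑) : t → L))) x := by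
        by_contra h
        have hins : AlgebraicIndepOn ℚ id (insert x t) :=
          (AlgebraicIndepOn.insert_iff hxt).mpr ⟨ht.prop.1, by
            rwa [Set.image_id, ← Subtype.range_coe (s := t)]⟩
        exact hxt (ht.le_of_ge ⟨hins, Set.insert_subset hx ht.prop.2⟩ (Set.subset_insert _ _)
          (Set.mem_insert _ _))
      rw [← IntermediateField.isAlgebraic_adjoin_iff] at halg
      exact isAlgebraic_iff_isIntegral.mp halg
  have : FiniteDimensional E (IntermediateField.adjoin E s) :=
    IntermediateField.finiteDimensional_adjoin hint
  have hF : SkolemMahlerLech (IntermediateField.adjoin E s) := hE.of_finiteDimensional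
  have hs : s ⊆ IntermediateField.adjoin E s := IntermediateField.subset_adjoin E s
  let A' : Matrix n n (IntermediateField.adjoin E s) :=
    Matrix.of fun i j => ⟨A i j, hs (Or.inl ⟨(i, j), rfl⟩)⟩
  let V' : Matrix n n (IntermediateField.adjoin E s) :=
    Matrix.of fun i j => ⟨V i j, hs (Or.inr ⟨(i, j), rfl⟩)⟩
  let f : Matrix n n (IntermediateField.adjoin E s) →+* Matrix n n L :=
    (algebraMap (IntermediateField.adjoin E s) L).mapMatrix
  have hdet : A'.det ≠ 0 := by
    intro h
    apply hA
    rw [show A = f A' from rfl, ← RingHom.map_det, h, map_zero]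
  have key (m : ℕ) (i j : n) : (A' ^ m * V') i j = 0 ↔ (A ^ m * V) i j = 0 := by
    rw [show A ^ m * V = f (A' ^ m * V') by rw [map_mul, map_pow]; rfl]
    exact (map_eq_zero (algebraMap (IntermediateField.adjoin E s) L)).symm
  obtain ⟨N, hN, h⟩ := hF n A' V' hdet
  exact ⟨N, hN, by simpa only [key] using h⟩

lemma exists_dfa_of_finite_state {σ : Type} [Fintype σ] (f : ℕ → σ) (step : σ → σ)
    (hf : ∀ m, f (m + 1) = step (f m)) (acc : Set σ) :
    ∃ M : DFA Unit σ, ∀ m, List.replicate m () ∈ M.accepts ↔ f m ∈ acc := by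
  refine ⟨⟨fun x _ => step x, f 0, acc⟩, fun m => ?_⟩
  rw [DFA.mem_accepts]
  suffices h : ∀ m k, List.foldl (fun x (_ : Unit) => step x) (f k) (List.replicate m ()) =
      f (k + m) by
    rw [DFA.eval, DFA.evalFrom, h, zero_add]
  intro m
  induction m with
  | zero => simp
  | succ m ih => intro k; rw [List.replicate_succ, List.foldl_cons, ← hf, ih]; congr 1; omega

lemma exists_dfa_of_eventually_separated {Y Z : Set ℕ} (hYZ : Disjoint Y Z) {N : ℕ} (hN : 0 < N)
    (h : ∀ r, {k | r + N * k ∈ Y}.Finite ∨ ∀ k, r + N * k ∉ Z) :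
    ∃ (σ : Type) (_ : Fintype σ) (M : DFA Unit σ),
      (∀ m ∈ Y, List.replicate m () ∈ M.accepts) ∧
      (∀ m ∈ Z, List.replicate m () ∉ M.accepts) := by
  have : NeZero N := ⟨hN.ne'⟩
  have hK : ∃ K, ∀ m ∈ Y, ∀ l ∈ Z, K ≤ m → m % N = l % N → False := by
    have hr (r : ℕ) : ∃ K, ∀ m ∈ Y, ∀ l ∈ Z, K ≤ m → m % N = r → l % N = r → False := by
      rcases h r with hfin | hr
      · obtain ⟨B, hB⟩ := hfin.bddAbove
        refine ⟨r + N * (B + 1), fun m hm l _ hKm hmr _ => ?_⟩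
        have h1 := Nat.mod_add_div m N
        rw [hmr] at h1
        have h2 : m / N ≤ B := hB (show r + N * (m / N) ∈ Y by rwa [h1])
        have h3 : N * (m / N) < N * (B + 1) := Nat.mul_lt_mul_of_pos_left (by omega) hN
        omega
      · refine ⟨0, fun m _ l hl _ _ hlr => hr (l / N) ?_⟩
        rwa [← hlr, Nat.mod_add_div]
    choose K hK using hr
    refine ⟨(Finset.range N).sup K, fun m hm l hl hKm hml => ?_⟩
    exact hK (m % N) m hm l hl
      ((Finset.le_sup (Finset.mem_range.mpr (Nat.mod_lt m hN))).trans hKm) rfl hml.symm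
  obtain ⟨K, hK⟩ := hK
  let f (m : ℕ) : Fin (K + 1) × ZMod N := (⟨min m K, by omega⟩, m)
  obtain ⟨M, hM⟩ := exists_dfa_of_finite_state f
    (fun x => (⟨min (x.1 + 1) K, by omega⟩, x.2 + 1))
    (fun m => by
      ext
      · simp only [f]; omega
      · simp [f]) (f '' Y)
  refine ⟨_, inferInstance, M, fun m hm => (hM m).mpr ⟨m, hm, rfl⟩, fun l hl hacc => ?_⟩
  obtain ⟨m, hm, hml⟩ := (hM l).mp hacc
  have h1 : min m K = min l K := congrArg (fun x => (x.1 : ℕ)) hml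
  have h2 : (m : ZMod N) = l := congrArg Prod.snd hml
  by_cases hmK : K ≤ m
  · exact hK m hm l hl hmK ((ZMod.natCast_eq_natCast_iff' m l N).mp h2)
  · have : m = l := by omega
    exact Set.disjoint_left.mp hYZ hm (this ▸ hl)


/-- A unary promise problem `(Pyes, Pno)` solved by a Las Vegas Moore–Crutchfield QFA with
success probability `p > 0` is also solved by a DFA over the one-letter alphabet. -/
theorem unary_las_vegas_qfa_implies_dfa
    (Pyes Pno : Set ℕ) (hdisj : Disjoint Pyes Pno)
    (q : ℕ) (U : Matrix.unitaryGroup (Fin q) ℂ)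
    (v₀ : Fin q → ℂ) (hv : ∑ j, ‖v₀ j‖ ^ 2 = 1)
    (Qa Qr : Finset (Fin q)) (hQ : Disjoint Qa Qr)
    (p : ℝ) (hp : 0 < p)
    (hyes : ∀ m ∈ Pyes,
      p ≤ ∑ j ∈ Qa, ‖((U : Matrix (Fin q) (Fin q) ℂ) ^ m).mulVec v₀ j‖ ^ 2 ∧
      ∑ j ∈ Qr, ‖((U : Matrix (Fin q) (Fin q) ℂ) ^ m).mulVec v₀ j‖ ^ 2 = 0)
    (hno : ∀ m ∈ Pno,
      p ≤ ∑ j ∈ Qr, ‖((U : Matrix (Fin q) (Fin q) ℂ) ^ m).mulVec v₀ j‖ ^ 2 ∧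
      ∑ j ∈ Qa, ‖((U : Matrix (Fin q) (Fin q) ℂ) ^ m).mulVec v₀ j‖ ^ 2 = 0) :
    ∃ (σ : Type) (_ : Fintype σ) (M : DFA Unit σ),
      (∀ m ∈ Pyes, List.replicate m () ∈ M.accepts) ∧
      (∀ m ∈ Pno, List.replicate m () ∉ M.accepts) := by
  have hdet : (U : Matrix (Fin q) (Fin q) ℂ).det ≠ 0 := by
    rw [← isUnit_iff_ne_zero, ← Matrix.isUnit_iff_isUnit_det]
    exact (Unitary.toUnits U).isUnit
  obtain ⟨N, hN, h⟩ := skolemMahlerLech_of_charZero ℂ (Fin q) U (Matrix.of fun i _ => v₀ i) hdet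
  have hentry (m : ℕ) (i j : Fin q) : ((U : Matrix (Fin q) (Fin q) ℂ) ^ m *
      Matrix.of fun i _ => v₀ i) i j = ((U : Matrix (Fin q) (Fin q) ℂ) ^ m).mulVec v₀ i := rfl
  have hsum (Q : Finset (Fin q)) (w : Fin q → ℂ) :
      ∑ j ∈ Q, ‖w j‖ ^ 2 = 0 ↔ ∀ j ∈ Q, w j = 0 := by
    rw [Finset.sum_eq_zero_iff_of_nonneg fun j _ => sq_nonneg _]
    simp
  simp only [hentry] at h
  refine exists_dfa_of_eventually_separated hdisj hN fun r => or_iff_not_imp_left.mpr ?_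
  intro hinf k hk
  refine hp.not_ge ((hno _ hk).1.trans_eq ((hsum _ _).mpr fun j hj => ?_))
  refine h r j j (Set.Infinite.mono (fun m hm => ?_) hinf) k
  exact (hsum _ (((U : Matrix (Fin q) (Fin q) ℂ) ^ (r + N * m)).mulVec v₀)).mp (hyes _ hm).2 j hj
end

section
/- Let (Pyes, Pno) be a unary promise problem. Suppose there is a unary PFA solving it with error bound ε < 1/2: a number of states q, a q×q real column-stochastic matrix A (all entries nonnegative, every column sums to 1), a stochastic initial vector v₀ ∈ ℝ^q (nonnegative entries summing to 1), a set Qa ⊆ Fin q, and ε ∈ [0, 1/2) such that f(m) = Σ_{j ∈ Qa} (A^m v₀)(j) satisfies f(m) ≥ 1 − ε for every m ∈ Pyes and f(m) ≤ ε for every m ∈ Pno. Then there exist a finite state type σ and a DFA over the one-letter alphabet that solves the promise problem. -/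
open Filter Topology Matrix

namespace UnaryPFA

section Stochastic

variable {ι : Type*} [Fintype ι] {B : Matrix ι ι ℝ}

/-- If `B` is column-stochastic with transitive support, then a positive upper bound for
`h - h ᵥ* B` is a strict upper bound for `(h - h ᵥ* B) ᵥ* B`. -/
lemma vecMul_sub_vecMul_lt (hB0 : ∀ i j, 0 ≤ B i j) (hB1 : ∀ i, ∑ j, B j i = 1)
    (hBt : ∀ i j k, 0 < B j i → 0 < B k j → 0 < B k i) (h : ι → ℝ) {c : ℝ} (hc : 0 < c)
    (hx : ∀ j, (h - h ᵥ* B) j ≤ c) (i : ι) : ((h - h ᵥ* B) ᵥ* B) i < c := by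
  by_contra! hi
  have hxc : ∀ j, 0 < B j i → (h - h ᵥ* B) j = c := by
    have hnn : ∀ j ∈ Finset.univ, 0 ≤ (c - (h - h ᵥ* B) j) * B j i := fun j _ =>
      mul_nonneg (sub_nonneg.2 (hx j)) (hB0 j i)
    have hsum : ∑ j, (c - (h - h ᵥ* B) j) * B j i = 0 := by
      refine le_antisymm ?_ (Finset.sum_nonneg hnn)
      have : ((h - h ᵥ* B) ᵥ* B) i = ∑ j, (h - h ᵥ* B) j * B j i := rfl
      simp only [sub_mul c, Finset.sum_sub_distrib, ← Finset.mul_sum, hB1]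
      linarith
    intro j hj
    have := (Finset.sum_eq_zero_iff_of_nonneg hnn).1 hsum j (Finset.mem_univ j)
    rcases mul_eq_zero.1 this with h0 | h0 <;> linarith
  have hne : (Finset.univ.filter fun j => 0 < B j i).Nonempty := by
    by_contra hempty
    have : ∑ j, B j i ≤ 0 := Finset.sum_nonpos fun j hj => by
      by_contra! hpos
      exact hempty ⟨j, by simpa using hpos⟩
    linarith [hB1 i]
  obtain ⟨j, hj, hmin⟩ := Finset.exists_min_image _ h hne
  simp only [Finset.mem_filter, Finset.mem_univ, true_and] at hj hmin
  have hle : h j ≤ (h ᵥ* B) j := by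
    calc h j = ∑ k, h j * B k j := by rw [← Finset.mul_sum, hB1, mul_one]
      _ ≤ ∑ k, h k * B k j := Finset.sum_le_sum fun k _ => by
        rcases (hB0 k j).eq_or_lt with h0 | h0
        · simp [← h0]
        · exact mul_le_mul_of_nonneg_right (hmin k (hBt i j k hj h0)) h0.le
  have := hxc j hj
  simp only [Pi.sub_apply] at this
  linarith

lemma norm_vecMul_sub_lt (hB0 : ∀ i j, 0 ≤ B i j) (hB1 : ∀ i, ∑ j, B j i = 1)
    (hBt : ∀ i j k, 0 < B j i → 0 < B k j → 0 < B k i) (h : ι → ℝ) (hne : h - h ᵥ* B ≠ 0) :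
    ‖(h - h ᵥ* B) ᵥ* B‖ < ‖h - h ᵥ* B‖ := by
  have hpos : 0 < ‖h - h ᵥ* B‖ := norm_pos_iff.2 hne
  refine (pi_norm_lt_iff hpos).2 fun i => ?_
  have hbound := fun j => abs_le.1 (norm_le_pi_norm (h - h ᵥ* B) j)
  refine abs_lt.2 ⟨?_, vecMul_sub_vecMul_lt hB0 hB1 hBt h hpos (fun j => (hbound j).2) i⟩
  have hneg : -h - -h ᵥ* B = -(h - h ᵥ* B) := by rw [neg_vecMul]; abel
  have := vecMul_sub_vecMul_lt hB0 hB1 hBt (-h) hpos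
    (fun j => by rw [hneg]; exact neg_le.1 (hbound j).1) i
  rw [hneg, neg_vecMul, Pi.neg_apply] at this
  linarith

/-- `B` acts as a strict contraction on the range of `h ↦ h - h ᵥ* B`. -/
lemma exists_norm_vecMul_sub_le (hB0 : ∀ i j, 0 ≤ B i j) (hB1 : ∀ i, ∑ j, B j i = 1)
    (hBt : ∀ i j k, 0 < B j i → 0 < B k j → 0 < B k i) :
    ∃ ρ : ℝ, 0 ≤ ρ ∧ ρ < 1 ∧
      ∀ h : ι → ℝ, ‖(h - h ᵥ* B) ᵥ* B‖ ≤ ρ * ‖h - h ᵥ* B‖ := by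
  set W : Submodule ℝ (ι → ℝ) := LinearMap.range (LinearMap.id - B.vecMulLinear) with hW
  have hmem : ∀ h : ι → ℝ, h - h ᵥ* B ∈ W := fun h => ⟨h, rfl⟩
  have hK : IsCompact (Metric.sphere (0 : ι → ℝ) 1 ∩ W) :=
    (isCompact_sphere _ _).inter_right W.closed_of_finiteDimensional
  have hcont : Continuous fun x : ι → ℝ => ‖x ᵥ* B‖ :=
    (LinearMap.continuous_of_finiteDimensional B.vecMulLinear).norm
  have hscale : ∀ h : ι → ℝ, h - h ᵥ* B ≠ 0 →
      ‖h - h ᵥ* B‖⁻¹ • (h - h ᵥ* B) ∈ Metric.sphere (0 : ι → ℝ) 1 ∩ W := fun h hne =>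
    ⟨by simp [norm_smul, inv_mul_cancel₀ (norm_ne_zero_iff.2 hne)], W.smul_mem _ (hmem h)⟩
  rcases (Metric.sphere (0 : ι → ℝ) 1 ∩ W).eq_empty_or_nonempty with hemp | hnon
  · refine ⟨0, le_rfl, one_pos, fun h => ?_⟩
    by_cases hne : h - h ᵥ* B = 0
    · simp [hne]
    · have := hscale h hne
      rw [hemp] at this
      exact this.elim
  · obtain ⟨x, ⟨hx1, h₀, hh₀⟩, hmax⟩ := hK.exists_isMaxOn hnon hcont.continuousOn
    have hxe : x = h₀ - h₀ ᵥ* B := hh₀.symm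
    have hxn : ‖x‖ = 1 := by simpa using hx1
    refine ⟨‖x ᵥ* B‖, norm_nonneg _, ?_, fun h => ?_⟩
    · have hx0 : x ≠ 0 := fun h0 => by simp [h0] at hxn
      rw [← hxn]
      subst hxe
      exact norm_vecMul_sub_lt hB0 hB1 hBt h₀ hx0
    · by_cases hne : h - h ᵥ* B = 0
      · simp [hne]
      · have := hmax (hscale h hne)
        simp only [Set.mem_ofPred_eq, smul_vecMul, norm_smul, norm_inv, norm_norm] at this
        rwa [inv_mul_le_iff₀ (norm_pos_iff.2 hne), mul_comm] at this

/-- Multiplying a row vector by the powers of a column-stochastic matrix with transitive support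
gives a Cauchy sequence. -/
lemma cauchySeq_vecMul_pow [DecidableEq ι] (hB0 : ∀ i j, 0 ≤ B i j)
    (hB1 : ∀ i, ∑ j, B j i = 1) (hBt : ∀ i j k, 0 < B j i → 0 < B k j → 0 < B k i)
    (h : ι → ℝ) : CauchySeq fun n : ℕ => h ᵥ* B ^ n := by
  obtain ⟨ρ, hρ0, hρ1, hρ⟩ := exists_norm_vecMul_sub_le hB0 hB1 hBt
  refine cauchySeq_of_le_geometric ρ ‖h - h ᵥ* B‖ hρ1 fun n => ?_
  have hstep : ∀ n, h ᵥ* B ^ (n + 1) = (h ᵥ* B ^ n) ᵥ* B := fun n => by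
    rw [vecMul_vecMul, pow_succ]
  rw [dist_eq_norm, hstep]
  induction n with
  | zero => simp
  | succ n ih =>
    have := hρ (h ᵥ* B ^ n)
    rw [sub_vecMul, ← hstep] at this
    calc _ ≤ _ := this
      _ ≤ ρ * (‖h - h ᵥ* B‖ * ρ ^ n) := by rw [hstep]; gcongr
      _ = _ := by ring

end Stochastic

section Powers

lemma mul_entry_pos_iff {ι : Type*} [Fintype ι] {M N : Matrix ι ι ℝ} (hM : ∀ i j, 0 ≤ M i j) (hN : ∀ i j, 0 ≤ N i j)
    (i j : ι) : 0 < (M * N) i j ↔ ∃ k, 0 < M i k ∧ 0 < N k j := by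
  rw [mul_apply, Finset.sum_pos_iff_of_nonneg fun k _ => mul_nonneg (hM i k) (hN k j)]
  refine ⟨fun ⟨k, _, hk⟩ => ⟨k, ?_⟩, fun ⟨k, h1, h2⟩ => ⟨k, Finset.mem_univ k, mul_pos h1 h2⟩⟩
  exact ⟨(pos_of_mul_pos_left hk (hN k j)), (pos_of_mul_pos_right hk (hM i k))⟩

variable {ι : Type*} [Fintype ι] [DecidableEq ι] {A : Matrix ι ι ℝ}

lemma pow_nonneg_entries (hA0 : ∀ i j, 0 ≤ A i j) (n : ℕ) : ∀ i j, 0 ≤ (A ^ n) i j := by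
  induction n with
  | zero => intro i j; rw [pow_zero, one_apply]; split_ifs <;> norm_num
  | succ n ih =>
    intro i j
    rw [pow_succ, mul_apply]
    exact Finset.sum_nonneg fun k _ => mul_nonneg (ih i k) (hA0 k j)

lemma pow_sum_col (hA1 : ∀ i, ∑ j, A j i = 1) (n : ℕ) : ∀ i, ∑ j, (A ^ n) j i = 1 := by
  induction n with
  | zero => intro i; simp [one_apply]
  | succ n ih =>
    intro i
    simp only [pow_succ, mul_apply]
    rw [Finset.sum_comm]
    simp [← Finset.sum_mul, ih, hA1]

/-- Some positive power of a nonnegative matrix has transitive support. -/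
lemma exists_pow_support_transitive (hA0 : ∀ i j, 0 ≤ A i j) :
    ∃ e : ℕ, 0 < e ∧
      ∀ i j k, 0 < (A ^ e) j i → 0 < (A ^ e) k j → 0 < (A ^ e) k i := by
  have hnn := pow_nonneg_entries hA0
  let S : ℕ → Set (ι × ι) := fun n => {p | 0 < (A ^ n) p.1 p.2}
  have hadd : ∀ a b n, S a = S b → S (a + n) = S (b + n) := by
    intro a b n hab
    ext ⟨i, j⟩
    change 0 < (A ^ (a + n)) i j ↔ 0 < (A ^ (b + n)) i j
    rw [pow_add, pow_add, mul_entry_pos_iff (hnn a) (hnn n), mul_entry_pos_iff (hnn b) (hnn n)]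
    have hk : ∀ k, 0 < (A ^ a) i k ↔ 0 < (A ^ b) i k := fun k => Set.ext_iff.1 hab (i, k)
    simp only [hk]
  obtain ⟨a, p, hp, hap⟩ : ∃ a p, 0 < p ∧ S a = S (a + p) := by
    obtain ⟨a, b, hne, hab⟩ := Finite.exists_ne_map_eq_of_infinite S
    rcases hne.lt_or_gt with hlt | hlt
    · exact ⟨a, b - a, by omega, by rw [hab]; congr 1; omega⟩
    · exact ⟨b, a - b, by omega, by rw [← hab]; congr 1; omega⟩
  have hper : ∀ n, a ≤ n → ∀ k, S n = S (n + p * k) := by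
    intro n hn k
    induction k with
    | zero => rfl
    | succ k ih =>
      have := hadd _ _ (n - a + p * k) hap
      rw [ih]
      convert this using 2
      · omega
      · rw [mul_add]; omega
  have hae : a ≤ p * (a + 1) := by nlinarith
  refine ⟨p * (a + 1), by positivity, fun i j k hij hjk => ?_⟩
  have : (k, i) ∈ S (p * (a + 1) + p * (a + 1)) := by
    change 0 < (A ^ (p * (a + 1) + p * (a + 1))) k i
    rw [pow_add, mul_entry_pos_iff (hnn _) (hnn _)]
    exact ⟨j, hjk, hij⟩
  rwa [← hper _ hae] at this

/-- Linear functionals of the powers of a column-stochastic matrix are asymptotically periodic. -/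
lemma exists_asymptotic_period (hA0 : ∀ i j, 0 ≤ A i j) (hA1 : ∀ i, ∑ j, A j i = 1)
    (u v : ι → ℝ) {η : ℝ} (hη : 0 < η) :
    ∃ e N : ℕ, 0 < e ∧ ∀ m m' : ℕ, N ≤ m → N ≤ m' → m ≡ m' [MOD e] →
      |u ⬝ᵥ (A ^ m *ᵥ v) - u ⬝ᵥ (A ^ m' *ᵥ v)| < η := by
  obtain ⟨e, he, htrans⟩ := exists_pow_support_transitive hA0
  have hcauchy : ∀ r : ℕ, ∃ N : ℕ, ∀ m ≥ N, ∀ n ≥ N,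
      |u ⬝ᵥ (A ^ (r + e * m) *ᵥ v) - u ⬝ᵥ (A ^ (r + e * n) *ᵥ v)| < η := by
    intro r
    obtain ⟨x, hx⟩ := cauchySeq_tendsto_of_complete (cauchySeq_vecMul_pow
      (pow_nonneg_entries hA0 e) (pow_sum_col hA1 e) htrans (u ᵥ* A ^ r))
    have hlim : Tendsto (fun n : ℕ => u ⬝ᵥ (A ^ (r + e * n) *ᵥ v)) atTop (𝓝 (x ⬝ᵥ v)) := by
      have hcont : Continuous fun y : ι → ℝ => y ⬝ᵥ v := by fun_prop
      refine ((hcont.tendsto x).comp hx).congr fun n => ?_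
      simp only [Function.comp_apply]
      rw [vecMul_vecMul, ← pow_mul, ← pow_add, dotProduct_mulVec]
    obtain ⟨N, hN⟩ := Metric.cauchySeq_iff.1 hlim.cauchySeq η hη
    exact ⟨N, fun m hm n hn => hN m hm n hn⟩
  choose N hN using hcauchy
  refine ⟨e, e * ((Finset.range e).sup N), he, fun m m' hm hm' hmod => ?_⟩
  have hr : N (m % e) ≤ (Finset.range e).sup N :=
    Finset.le_sup (Finset.mem_range.2 (Nat.mod_lt m he))
  have key : ∀ k, e * ((Finset.range e).sup N) ≤ k → N (m % e) ≤ k / e := fun k hk =>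
    hr.trans ((Nat.le_div_iff_mul_le he).2 (by rwa [mul_comm]))
  have := hN (m % e) (m / e) (key m hm) (m' / e) (key m' hm')
  rw [Nat.mod_add_div] at this
  rwa [show m % e = m' % e from hmod, Nat.mod_add_div] at this

end Powers

/-- The one-letter DFA that counts exactly up to `N` and also modulo `e`. -/
def counterDFA (N e : ℕ) (P : Set ℕ) : DFA Unit (Fin (N + 1) × ZMod e) where
  step s _ := (⟨min (s.1 + 1) N, by omega⟩, s.2 + 1)
  start := (0, 0)
  accept := {s | ∃ m ∈ P, s.1.val = min m N ∧ s.2 = m}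

lemma counterDFA_eval (N e : ℕ) (P : Set ℕ) (m : ℕ) :
    (counterDFA N e P).eval (List.replicate m ()) = (⟨min m N, by omega⟩, (m : ZMod e)) := by
  induction m with
  | zero => simp [counterDFA]
  | succ m ih =>
    rw [List.replicate_succ', DFA.eval_append_singleton, ih]
    simp only [counterDFA, Nat.cast_add, Nat.cast_one, Prod.mk.injEq, Fin.mk.injEq, and_true]
    omega

lemma replicate_mem_counterDFA_accepts (N e : ℕ) (P : Set ℕ) (m : ℕ) :
    List.replicate m () ∈ (counterDFA N e P).accepts ↔
      ∃ n ∈ P, min m N = min n N ∧ m ≡ n [MOD e] := by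
  rw [DFA.mem_accepts, counterDFA_eval]
  simp [counterDFA, ZMod.natCast_eq_natCast_iff]

end UnaryPFA


/-- A unary promise problem `(Pyes, Pno)` solved by a PFA with error bound `ε < 1/2` is also
solved by a DFA over the one-letter alphabet. -/
theorem unary_bounded_error_pfa_implies_dfa
    (Pyes Pno : Set ℕ) (hdisj : Disjoint Pyes Pno)
    (q : ℕ) (A : Matrix (Fin q) (Fin q) ℝ)
    (hA0 : ∀ i j, 0 ≤ A i j) (hA1 : ∀ i, ∑ j, A j i = 1)
    (v₀ : Fin q → ℝ) (hv0 : ∀ i, 0 ≤ v₀ i) (hv1 : ∑ i, v₀ i = 1)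
    (Qa : Finset (Fin q)) (ε : ℝ) (hε0 : 0 ≤ ε) (hε : ε < 1 / 2)
    (hyes : ∀ m ∈ Pyes, 1 - ε ≤ ∑ j ∈ Qa, (A ^ m).mulVec v₀ j)
    (hno : ∀ m ∈ Pno, ∑ j ∈ Qa, (A ^ m).mulVec v₀ j ≤ ε) :
    ∃ (σ : Type) (_ : Fintype σ) (M : DFA Unit σ),
      (∀ m ∈ Pyes, List.replicate m () ∈ M.accepts) ∧
      (∀ m ∈ Pno, List.replicate m () ∉ M.accepts) := by
  classical
  have hf : ∀ m, ∑ j ∈ Qa, (A ^ m).mulVec v₀ j =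
      (fun j => if j ∈ Qa then (1 : ℝ) else 0) ⬝ᵥ (A ^ m *ᵥ v₀) := fun m => by
    simp [dotProduct]
  obtain ⟨e, N, he, hper⟩ := UnaryPFA.exists_asymptotic_period hA0 hA1
    (fun j => if j ∈ Qa then (1 : ℝ) else 0) v₀ (η := 1 - 2 * ε) (by linarith)
  have : NeZero e := ⟨he.ne'⟩
  refine ⟨_, inferInstance, UnaryPFA.counterDFA N e Pyes, fun m hm => ?_, fun m hm hacc => ?_⟩
  · exact (UnaryPFA.replicate_mem_counterDFA_accepts N e Pyes m).2 ⟨m, hm, rfl, rfl⟩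
  · obtain ⟨n, hn, hmin, hmod⟩ := (UnaryPFA.replicate_mem_counterDFA_accepts N e Pyes m).1 hacc
    by_cases hmn : m = n
    · exact Set.disjoint_left.1 hdisj hn (hmn ▸ hm)
    · have hlt := abs_lt.1 (hper m n (by omega) (by omega) hmod)
      have h1 := hyes n hn
      have h2 := hno m hm
      rw [hf] at h1 h2
      linarith [hlt.1]
end

section
/- Fix a real φ with φ/π irrational and θ ∈ (0, π/4). Let U be the 2×2 real rotation matrix !![cos φ, −sin φ; sin φ, cos φ] and let e₀ = (1, 0). Then: (i) sin²θ < 1/2; (ii) for every m ∈ Lθyes, the quantity ((U^m e₀) 0)² is at least 1 − sin²θ; and (iii) for every m ∈ Lθno, the quantity ((U^m e₀) 0)² is at most sin²θ. (Thus the 2-state MCQFA with real transitions given by U, initial state e₀ and accepting state 0 solves the promise problem L^θ with error bound sin²θ < 1/2.) -/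
open Real

theorem rotation_matrix_pow (φ : ℝ) (m : ℕ) :
    (!![Real.cos φ, -Real.sin φ; Real.sin φ, Real.cos φ] : Matrix (Fin 2) (Fin 2) ℝ) ^ m =
      !![Real.cos (m * φ), -Real.sin (m * φ); Real.sin (m * φ), Real.cos (m * φ)] := by
  induction m with
  | zero => simp [Matrix.one_fin_two]
  | succ k ih =>
    rw [pow_succ, ih, Matrix.mul_fin_two, Nat.cast_succ, add_mul, one_mul, Real.cos_add,
      Real.sin_add]
    congr! 3 <;> ring_nf

theorem rotation_matrix_pow_mulVec_apply_zero (φ : ℝ) (m : ℕ) :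
    ((!![Real.cos φ, -Real.sin φ; Real.sin φ, Real.cos φ] : Matrix (Fin 2) (Fin 2) ℝ) ^ m).mulVec
      ![1, 0] 0 = Real.cos (m * φ) := by
  rw [rotation_matrix_pow]
  simp [Matrix.mulVec, dotProduct]

theorem sin_sq_le_sin_sq_of_mem_Icc_nat_mul_pi {x θ : ℝ} (hθ : θ ≤ π / 2) (l : ℕ)
    (hx : x ∈ Set.Icc (l * π - θ) (l * π + θ)) : Real.sin x ^ 2 ≤ Real.sin θ ^ 2 := by
  obtain ⟨hx₁, hx₂⟩ := hx
  have hshift : Real.sin x ^ 2 = Real.sin (x - l * π) ^ 2 := by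
    rw [Real.sin_sub_nat_mul_pi, mul_pow, ← pow_mul, mul_comm l 2, pow_mul]
    simp
  rw [hshift]
  apply sq_le_sq'
  · rw [← Real.sin_neg]
    exact Real.sin_le_sin_of_le_of_le_pi_div_two (by linarith) (by linarith) (by linarith)
  · exact Real.sin_le_sin_of_le_of_le_pi_div_two (by linarith) (by linarith) (by linarith)

/-- The 2-state Moore–Crutchfield QFA given by rotation through angle `φ`, initial state
`(1,0)` and accepting state `0`, solves the unary promise problem `L^θ` with error bound
`sin² θ < 1/2`. -/
theorem two_state_qfa_solves_Ltheta
    (φ θ : ℝ) (hφ : Irrational (φ / π)) (hθ : θ ∈ Set.Ioo 0 (π / 4)) :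
    Real.sin θ ^ 2 < 1 / 2 ∧
    (∀ m : ℕ, (∃ l : ℕ, (m : ℝ) * φ ∈ Set.Icc (l * π - θ) (l * π + θ)) →
      1 - Real.sin θ ^ 2 ≤
        (((!![Real.cos φ, -Real.sin φ; Real.sin φ, Real.cos φ] : Matrix (Fin 2) (Fin 2) ℝ) ^ m).mulVec
          ![1, 0] 0) ^ 2) ∧
    (∀ m : ℕ, (∃ l : ℕ, (m : ℝ) * φ ∈ Set.Icc (l * π + π / 2 - θ) (l * π + π / 2 + θ)) →
      (((!![Real.cos φ, -Real.sin φ; Real.sin φ, Real.cos φ] : Matrix (Fin 2) (Fin 2) ℝ) ^ m).mulVec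
        ![1, 0] 0) ^ 2 ≤ Real.sin θ ^ 2) := by
  obtain ⟨hθ₀, hθ₁⟩ := hθ
  have hθ₂ : θ ≤ π / 2 := by linarith [Real.pi_pos]
  simp only [rotation_matrix_pow_mulVec_apply_zero]
  refine ⟨?_, ?_, ?_⟩
  · have hcos : 0 < Real.cos (2 * θ) :=
      Real.cos_pos_of_mem_Ioo ⟨by linarith [Real.pi_pos], by linarith⟩
    rw [Real.sin_sq_eq_half_sub]
    linarith
  · rintro m ⟨l, hl⟩
    rw [Real.cos_sq']
    linarith [sin_sq_le_sin_sq_of_mem_Icc_nat_mul_pi hθ₂ l hl]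
  · rintro m ⟨l, hl₁, hl₂⟩
    have hsin := sin_sq_le_sin_sq_of_mem_Icc_nat_mul_pi (x := m * φ - π / 2) hθ₂ l
      ⟨by linarith, by linarith⟩
    rwa [Real.sin_sub_pi_div_two, neg_sq] at hsin
end

section
/- Let n, k be positive integers. There exists a 2k-state MCQFA solving L^{k,n} with one-sided error 1/3: there exist a unitary matrix U ∈ Matrix.unitaryGroup (Fin (2k)) ℂ, a vector v₀ ∈ ℂ^{2k} of norm 1, and a set Qa ⊆ Fin (2k) such that f(m) = Σ_{j ∈ Qa} ‖(U^m v₀)(j)‖² satisfies f(m) = 1 for every m ∈ Lyes (i.e. N ∣ m) and f(m) ≤ 2/3 for every m ∈ Lno. -/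
/-- `nthPrime j` is the `j`-th prime number (1-indexed: `nthPrime 1 = 2`). -/
noncomputable def nthPrime (j : ℕ) : ℕ := Nat.nth Nat.Prime (j - 1)

/-- The residue of `m` mod `p` lies in `[p/8, 3p/8] ∪ [5p/8, 7p/8]` (over `ℝ`). -/
def badResidue (p m : ℕ) : Prop :=
  ((m % p : ℕ) : ℝ) ∈ Set.Icc ((p : ℝ) / 8) (3 * p / 8) ∪ Set.Icc (5 * (p : ℝ) / 8) (7 * p / 8)

/-- The number of indices `j ∈ {n, …, n+k-1}` with `(m mod p_j)` in the bad intervals. -/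
noncomputable def noCount (n k m : ℕ) : ℕ :=
  letI : DecidablePred fun j => badResidue (nthPrime j) m :=
    fun j => Classical.dec _
  ((Finset.Ico n (n + k)).filter fun j => badResidue (nthPrime j) m).card

/-- The set of no-instances of the promise problem `L^{k,n}`. -/
def Lno (n k : ℕ) : Set ℕ := {m | (2 * k : ℝ) / 3 ≤ noCount n k m}

/-- `N = p_n ⋯ p_{n+k-1}`, the product of the `k` primes starting from the `n`-th. -/
noncomputable def Nprod (n k : ℕ) : ℕ := ∏ j ∈ Finset.Ico n (n + k), nthPrime j

/-- The rotation of the plane by the angle `θ`, as a complex matrix. -/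
noncomputable def rotationMatrix (θ : ℝ) : Matrix (Fin 2) (Fin 2) ℂ :=
  !![(Real.cos θ : ℂ), -(Real.sin θ : ℂ); (Real.sin θ : ℂ), (Real.cos θ : ℂ)]

theorem rotationMatrix_zero : rotationMatrix 0 = 1 := by
  simp [rotationMatrix, Matrix.one_fin_two]

theorem rotationMatrix_mul (α β : ℝ) :
    rotationMatrix α * rotationMatrix β = rotationMatrix (α + β) := by
  ext i j
  fin_cases i <;> fin_cases j <;>
    simp [rotationMatrix, Matrix.mul_apply, Fin.sum_univ_two, Complex.cos_add, Complex.sin_add] <;>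
    ring

theorem rotationMatrix_pow (θ : ℝ) (m : ℕ) :
    rotationMatrix θ ^ m = rotationMatrix (m * θ) := by
  induction m with
  | zero => simp [rotationMatrix_zero]
  | succ m ih =>
    rw [pow_succ, ih, rotationMatrix_mul]
    congr 1
    push_cast
    ring

theorem star_rotationMatrix (θ : ℝ) : star (rotationMatrix θ) = rotationMatrix (-θ) := by
  ext i j
  fin_cases i <;> fin_cases j <;>
    simp [rotationMatrix, Matrix.star_apply, ← Complex.cos_conj, ← Complex.sin_conj]

/-- The direct sum of the plane rotations by the angles `θ i`. -/
noncomputable def rotationSum {k : ℕ} (θ : Fin k → ℝ) : Matrix (Fin (2 * k)) (Fin (2 * k)) ℂ :=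
  Matrix.reindexAlgEquiv ℂ ℂ finProdFinEquiv
    (Matrix.blockDiagonal fun i => rotationMatrix (θ i))

theorem rotationSum_pow {k : ℕ} (θ : Fin k → ℝ) (m : ℕ) :
    rotationSum θ ^ m = rotationSum fun i => m * θ i := by
  rw [rotationSum, ← map_pow, ← Matrix.blockDiagonal_pow]
  simp only [rotationSum, Pi.pow_def, rotationMatrix_pow]

theorem star_rotationSum {k : ℕ} (θ : Fin k → ℝ) :
    star (rotationSum θ) = rotationSum fun i => -θ i := by
  simp only [rotationSum, Matrix.star_eq_conjTranspose, Matrix.coe_reindexAlgEquiv,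
    Matrix.conjTranspose_reindex, Matrix.blockDiagonal_conjTranspose]
  simp only [← Matrix.star_eq_conjTranspose, star_rotationMatrix]

theorem rotationSum_mem_unitaryGroup {k : ℕ} (θ : Fin k → ℝ) :
    rotationSum θ ∈ Matrix.unitaryGroup (Fin (2 * k)) ℂ := by
  rw [Matrix.mem_unitaryGroup_iff, star_rotationSum]
  simp only [rotationSum]
  rw [← map_mul, ← Matrix.blockDiagonal_mul]
  simp only [rotationMatrix_mul, add_neg_cancel, rotationMatrix_zero]
  rw [← Pi.one_def, Matrix.blockDiagonal_one, map_one]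

/-- The uniform superposition of the first basis vectors of the `k` planes. -/
noncomputable def uniformStart (k : ℕ) (j : Fin (2 * k)) : ℂ :=
  if (finProdFinEquiv.symm j).1 = 0 then ((√(k : ℝ))⁻¹ : ℝ) else 0

/-- The first basis vectors of the `k` planes. -/
def firstStates (k : ℕ) : Finset (Fin (2 * k)) :=
  Finset.univ.map ⟨fun i : Fin k => finProdFinEquiv ((0 : Fin 2), i),
    fun i j h => by simpa using finProdFinEquiv.injective h⟩

theorem sum_norm_sq_uniformStart {k : ℕ} (hk : 0 < k) : ∑ j, ‖uniformStart k j‖ ^ 2 = 1 := by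
  rw [← finProdFinEquiv.sum_comp, Fintype.sum_prod_type]
  have hk' : (k : ℝ) ≠ 0 := by positivity
  simp [uniformStart, Fin.sum_univ_two, hk', -finProdFinEquiv_apply_val]

theorem rotationSum_mulVec_uniformStart {k : ℕ} (θ : Fin k → ℝ) (i : Fin k) :
    (rotationSum θ).mulVec (uniformStart k) (finProdFinEquiv ((0 : Fin 2), i)) =
      ((Real.cos (θ i) * (√(k : ℝ))⁻¹ : ℝ) : ℂ) := by
  rw [Matrix.mulVec, dotProduct, ← finProdFinEquiv.sum_comp, Fintype.sum_prod_type]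
  simp [rotationSum, uniformStart, Matrix.blockDiagonal_apply, rotationMatrix]

theorem acceptance_eq {k : ℕ} (θ : Fin k → ℝ) (m : ℕ) :
    ∑ j ∈ firstStates k, ‖(rotationSum θ ^ m).mulVec (uniformStart k) j‖ ^ 2 =
      (∑ i, Real.cos (m * θ i) ^ 2) / k := by
  rw [firstStates, Finset.sum_map, Finset.sum_div, rotationSum_pow]
  refine Finset.sum_congr rfl fun i _ => ?_
  change ‖(rotationSum _).mulVec (uniformStart k) (finProdFinEquiv ((0 : Fin 2), i))‖ ^ 2 = _
  rw [rotationSum_mulVec_uniformStart, Complex.norm_real,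
    Real.norm_eq_abs, sq_abs, mul_pow, inv_pow, Real.sq_sqrt (Nat.cast_nonneg k), div_eq_mul_inv]

theorem nthPrime_prime (j : ℕ) : (nthPrime j).Prime := Nat.prime_nth_prime _

theorem cos_two_pi_mul_div_mod {p : ℕ} (hp : 0 < p) (m : ℕ) :
    Real.cos (m * (2 * Real.pi / p)) = Real.cos (2 * Real.pi * ((m % p : ℕ) / p)) := by
  have hp' : (p : ℝ) ≠ 0 := by positivity
  rw [← Real.cos_add_nat_mul_two_pi (2 * Real.pi * ((m % p : ℕ) / p)) (m / p)]
  congr 1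
  have h : (m : ℝ) = (m % p : ℕ) + p * (m / p : ℕ) := by exact_mod_cast (Nat.mod_add_div m p).symm
  rw [h]
  field_simp

theorem cos_sq_le_half_of_badResidue {p : ℕ} (hp : 0 < p) {m : ℕ} (h : badResidue p m) :
    Real.cos (m * (2 * Real.pi / p)) ^ 2 ≤ 1 / 2 := by
  rw [cos_two_pi_mul_div_mod hp, Real.cos_sq]
  have hp' : (0 : ℝ) < p := by positivity
  have hpi := Real.pi_pos
  set x : ℝ := ((m % p : ℕ) : ℝ) / p with hx
  suffices Real.cos (2 * (2 * Real.pi * x)) ≤ 0 by linarith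
  rcases h with ⟨h₁, h₂⟩ | ⟨h₁, h₂⟩
  · have h₁ : 1 / 8 ≤ x := by rw [hx, le_div_iff₀ hp']; linarith
    have h₂ : x ≤ 3 / 8 := by rw [hx, div_le_iff₀ hp']; linarith
    exact Real.cos_nonpos_of_pi_div_two_le_of_le (by nlinarith) (by nlinarith)
  · have h₁ : 5 / 8 ≤ x := by rw [hx, le_div_iff₀ hp']; linarith
    have h₂ : x ≤ 7 / 8 := by rw [hx, div_le_iff₀ hp']; linarith
    rw [← Real.cos_sub_two_pi]
    exact Real.cos_nonpos_of_pi_div_two_le_of_le (by nlinarith) (by nlinarith)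

theorem sum_cos_sq_le (n k m : ℕ) :
    ∑ i : Fin k, Real.cos (m * (2 * Real.pi / nthPrime (n + i))) ^ 2 ≤ k - noCount n k m / 2 := by
  classical
  have hcount : (noCount n k m : ℝ) =
      ∑ j ∈ Finset.Ico n (n + k), if badResidue (nthPrime j) m then (1 : ℝ) else 0 := by
    rw [Finset.sum_boole, noCount]
  rw [hcount, Finset.sum_Ico_eq_sum_range, Nat.add_sub_cancel_left,
    Fin.sum_univ_eq_sum_range
      (fun i => Real.cos (m * (2 * Real.pi / nthPrime (n + i))) ^ 2) k, Finset.sum_div]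
  calc _ ≤ ∑ i ∈ Finset.range k,
        (1 - (if badResidue (nthPrime (n + i)) m then (1 : ℝ) else 0) / 2) := by
        refine Finset.sum_le_sum fun i _ => ?_
        split_ifs with h
        · linarith [cos_sq_le_half_of_badResidue (nthPrime_prime _).pos h]
        · simpa using Real.cos_sq_le_one _
    _ = _ := by simp [Finset.sum_sub_distrib]

/-- There is a `2k`-state Moore–Crutchfield QFA solving `L^{k,n}` with one-sided error `1/3`:
yes-instances (multiples of `N`) are accepted with probability `1` and no-instances with
probability at most `2/3`. -/
theorem qfa_solves_Lkn (n k : ℕ) (hn : 0 < n) (hk : 0 < k) :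
    ∃ (U : Matrix.unitaryGroup (Fin (2 * k)) ℂ) (v₀ : Fin (2 * k) → ℂ)
      (Qa : Finset (Fin (2 * k))),
      (∑ j, ‖v₀ j‖ ^ 2 = 1) ∧
      (∀ m : ℕ, Nprod n k ∣ m →
        ∑ j ∈ Qa, ‖((U : Matrix (Fin (2 * k)) (Fin (2 * k)) ℂ) ^ m).mulVec v₀ j‖ ^ 2 = 1) ∧
      (∀ m ∈ Lno n k,
        ∑ j ∈ Qa, ‖((U : Matrix (Fin (2 * k)) (Fin (2 * k)) ℂ) ^ m).mulVec v₀ j‖ ^ 2 ≤ 2 / 3) := by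
  have hk' : (0 : ℝ) < k := by positivity
  refine ⟨⟨rotationSum fun i : Fin k => 2 * Real.pi / nthPrime (n + i),
    rotationSum_mem_unitaryGroup _⟩, uniformStart k, firstStates k,
    sum_norm_sq_uniformStart hk, fun m hm => ?_, fun m hm => ?_⟩
  · rw [acceptance_eq, div_eq_one_iff_eq hk'.ne']
    have hcos (i : Fin k) : Real.cos (m * (2 * Real.pi / nthPrime (n + i))) ^ 2 = 1 := by
      have hdvd : nthPrime (n + i) ∣ m :=
        (Finset.dvd_prod_of_mem nthPrime (Finset.mem_Ico.2 ⟨by lia, by lia⟩)).trans hm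
      rw [cos_two_pi_mul_div_mod (nthPrime_prime _).pos, Nat.mod_eq_zero_of_dvd hdvd]
      simp
    simp [hcos]
  · rw [acceptance_eq, div_le_iff₀ hk']
    have h := sum_cos_sq_le n k m
    have hm : (2 * k : ℝ) / 3 ≤ noCount n k m := hm
    linarith
end

section
/- Let n, k be positive integers and let s = p_n + p_{n+1} + ⋯ + p_{n+k−1}. There exists a unary PFA with s states solving L^{k,n} with one-sided error bound 1/3: there are an s×s real column-stochastic matrix A, a stochastic initial vector v₀ ∈ ℝ^s, and a set Qa ⊆ Fin s such that f(m) = Σ_{j ∈ Qa} (A^m v₀)(j) satisfies f(m) = 1 for every m with N ∣ m, and f(m) ≤ 1/3 for every m ∈ Lno. -/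
open Finset in
/-- The disjoint union of the cyclic counters modulo `p i`, `i ∈ I`, as a permutation of
`Fin (∑ i ∈ I, p i)`: started at `0`, the `i`-th counter is back at `0` after `m` steps if and
only if `p i ∣ m`. -/
theorem exists_perm_card_filter_pow_mem {ι : Type*} (I : Finset ι) (p : ι → ℕ)
    (hp : ∀ i ∈ I, p i ≠ 0) :
    ∃ (π : Equiv.Perm (Fin (∑ i ∈ I, p i))) (S : Finset (Fin (∑ i ∈ I, p i))), #S = #I ∧
      ∀ m : ℕ, #{a ∈ S | (π ^ m) a ∈ S} = #{i ∈ I | p i ∣ m} := by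
  have (i : I) : NeZero (p i) := ⟨hp i i.2⟩
  have hcard : Fintype.card (Σ i : I, ZMod (p i)) = ∑ i ∈ I, p i := by
    simp [ZMod.card, sum_attach I p]
  let e := Fintype.equivFinOfCardEq hcard
  let τ : Equiv.Perm (Σ i : I, ZMod (p i)) := Equiv.sigmaCongrRight fun _ ↦ Equiv.subRight 1
  have hτ (m : ℕ) (i : I) (x : ZMod (p i)) : (τ ^ m) ⟨i, x⟩ = ⟨i, x - m⟩ := by
    induction m with
    | zero => simp
    | succ m ih =>
      rw [pow_succ', Equiv.Perm.mul_apply, ih]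
      simp [τ, sub_sub]
  let π := e.permCongrHom τ
  have hπ (m : ℕ) (a : Σ i : I, ZMod (p i)) : (π ^ m) (e a) = e ((τ ^ m) a) := by
    simp only [π, ← map_pow]
    simp [Equiv.permCongrHom]
  let z : I ↪ Fin (∑ i ∈ I, p i) :=
    ⟨fun i ↦ e ⟨i, 0⟩, fun i j h ↦ congrArg Sigma.fst (e.injective h)⟩
  refine ⟨π, univ.map z, by simp, fun m ↦ ?_⟩
  have hz (i : I) : (π ^ m) (z i) ∈ univ.map z ↔ p i ∣ m := by
    have : (∃ j : I, (⟨j, 0⟩ : Σ i : I, ZMod (p i)) = ⟨i, 0 - m⟩) ↔ p i ∣ m := by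
      rw [← ZMod.natCast_eq_zero_iff]
      constructor
      · rintro ⟨j, h⟩
        obtain ⟨rfl, h⟩ := Sigma.mk.inj_iff.mp h
        simpa using h
      · intro h
        exact ⟨i, by simp [h]⟩
    have hzi (j : I) : z j = e ⟨j, 0⟩ := rfl
    simpa only [hzi, hπ, hτ, mem_map, mem_univ, true_and, e.injective.eq_iff] using this
  rw [filter_map, card_map]
  simp only [Function.comp_def, hz]
  rw [univ_eq_attach, filter_attach (fun i ↦ p i ∣ m), card_map, card_attach]

theorem not_dvd_of_badResidue {p m : ℕ} (hp : 0 < p) (h : badResidue p m) : ¬ p ∣ m := by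
  intro hd
  have hp' : (0 : ℝ) < p := by exact_mod_cast hp
  simp only [badResidue, Nat.mod_eq_zero_of_dvd hd, Nat.cast_zero, Set.mem_union,
    Set.mem_Icc] at h
  rcases h with h | h <;> linarith [h.1]

open Finset in
theorem card_filter_dvd_add_noCount_le (n k m : ℕ) :
    #{j ∈ Ico n (n + k) | nthPrime j ∣ m} + noCount n k m ≤ k := by
  classical
  rw [noCount, ← card_union_of_disjoint]
  · refine (card_le_card (union_subset (filter_subset _ _) (filter_subset _ _))).trans ?_
    simp
  · rw [disjoint_filter]
    exact fun j _ hd hb ↦ not_dvd_of_badResidue (nthPrime_prime j).pos hb hd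

theorem Equiv.Perm.permMatrix_pow_mulVec {ι R : Type*} [Fintype ι] [DecidableEq ι] [CommRing R]
    (π : Equiv.Perm ι) (m : ℕ) (v : ι → R) :
    ((π.permMatrix R) ^ m).mulVec v = v ∘ ⇑(π ^ m) := by
  induction m with
  | zero => simp
  | succ m ih =>
    rw [pow_succ', ← Matrix.mulVec_mulVec, ih, Matrix.permMatrix_mulVec, pow_succ]
    rfl

/-- There is a PFA with `s = p_n + ⋯ + p_{n+k-1}` states solving `L^{k,n}` with one-sided
error bound `1/3`. -/
theorem pfa_solves_Lkn (n k : ℕ) (hn : 0 < n) (hk : 0 < k) :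
    ∃ (A : Matrix (Fin (∑ j ∈ Finset.Ico n (n + k), nthPrime j))
          (Fin (∑ j ∈ Finset.Ico n (n + k), nthPrime j)) ℝ)
      (v₀ : Fin (∑ j ∈ Finset.Ico n (n + k), nthPrime j) → ℝ)
      (Qa : Finset (Fin (∑ j ∈ Finset.Ico n (n + k), nthPrime j))),
      (∀ i j, 0 ≤ A i j) ∧ (∀ i, ∑ j, A j i = 1) ∧
      (∀ i, 0 ≤ v₀ i) ∧ (∑ i, v₀ i = 1) ∧
      (∀ m : ℕ, Nprod n k ∣ m → ∑ j ∈ Qa, (A ^ m).mulVec v₀ j = 1) ∧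
      (∀ m ∈ Lno n k, ∑ j ∈ Qa, (A ^ m).mulVec v₀ j ≤ 1 / 3) := by
  obtain ⟨π, S, hS, hπ⟩ := exists_perm_card_filter_pow_mem (Finset.Ico n (n + k)) nthPrime
    fun j _ ↦ (nthPrime_prime j).ne_zero
  rw [Nat.card_Ico, Nat.add_sub_cancel_left] at hS
  have hk' : (0 : ℝ) < k := by exact_mod_cast hk
  have hf (m : ℕ) :
      ∑ j ∈ S, ((π.permMatrix ℝ) ^ m).mulVec (fun i ↦ if i ∈ S then (k : ℝ)⁻¹ else 0) j =
        ((Finset.Ico n (n + k)).filter fun j ↦ nthPrime j ∣ m).card / k := by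
    simp only [Equiv.Perm.permMatrix_pow_mulVec, Function.comp_apply]
    rw [← Finset.sum_filter, Finset.sum_const, hπ, nsmul_eq_mul, div_eq_mul_inv]
  refine ⟨π.permMatrix ℝ, fun i ↦ if i ∈ S then (k : ℝ)⁻¹ else 0, S, fun i j ↦ ?_, fun i ↦ ?_,
    fun i ↦ ?_, ?_, fun m hm ↦ ?_, fun m hm ↦ ?_⟩
  · rw [Equiv.Perm.permMatrix, PEquiv.toMatrix_apply]
    positivity
  · simp [Equiv.Perm.permMatrix, PEquiv.toMatrix_apply, ← Equiv.eq_symm_apply]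
  · positivity
  · rw [Finset.sum_ite_mem, Finset.univ_inter, Finset.sum_const, hS, nsmul_eq_mul,
      mul_inv_cancel₀ hk'.ne']
  · rw [hf, Finset.filter_true_of_mem fun j hj ↦ (Finset.dvd_prod_of_mem nthPrime hj).trans hm,
      Nat.card_Ico, Nat.add_sub_cancel_left, div_self hk'.ne']
  · have hm' : (2 * k : ℝ) / 3 ≤ noCount n k m := hm
    have h : (((Finset.Ico n (n + k)).filter fun j ↦ nthPrime j ∣ m).card : ℝ) +
        noCount n k m ≤ k := mod_cast card_filter_dvd_add_noCount_le n k m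
    rw [hf, div_le_iff₀ hk']
    linarith
end

section
/- Let n ≥ 1 and k ≥ 3 be integers and let t = p_n · p_{n+1} ⋯ p_{n+⌊k/3⌋+1}. There exists a DFA over the one-letter alphabet with state type ZMod t (hence exactly t states) that solves L^{k,n}: for every m with N ∣ m the word of length m is accepted, and for every m ∈ Lno the word of length m is rejected. Equivalently: (i) N ∣ m implies t ∣ m; and (ii) if t ∣ m then the number of indices j ∈ {n,…,n+k−1} with (m mod p_j) ∈ [p_j/8, 3p_j/8] ∪ [5p_j/8, 7p_j/8] is strictly less than 2k/3. -/
theorem nthPrime_pos (j : ℕ) : 0 < nthPrime j :=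
  (Nat.prime_nth_prime (j - 1)).pos

theorem not_badResidue_of_dvd {p m : ℕ} (hp : 0 < p) (h : p ∣ m) : ¬ badResidue p m := by
  have hp' : (0 : ℝ) < p := by exact_mod_cast hp
  rw [badResidue, Nat.mod_eq_zero_of_dvd h]
  rintro (h | h)
  · have := h.1
    push_cast at this
    linarith
  · have := h.1
    push_cast at this
    linarith

theorem noCount_add_card_le {n k m : ℕ} {s : Finset ℕ} (hs : s ⊆ Finset.Ico n (n + k))
    (h : ∏ j ∈ s, nthPrime j ∣ m) : noCount n k m + s.card ≤ k := by
  classical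
  have hle : noCount n k m ≤ (Finset.Ico n (n + k) \ s).card := by
    refine Finset.card_le_card fun j hj => ?_
    obtain ⟨hj, hbad⟩ := Finset.mem_filter.1 hj
    refine Finset.mem_sdiff.2 ⟨hj, fun hjs => ?_⟩
    exact not_badResidue_of_dvd (nthPrime_pos j) ((Finset.dvd_prod_of_mem _ hjs).trans h) hbad
  have hcard := Finset.card_sdiff_add_card_eq_card hs
  rw [Nat.card_Ico] at hcard
  omega

/-- The cyclic automaton on `ZMod t` that accepts the words of length divisible by `t`. -/
def cyclicDFA (t : ℕ) : DFA Unit (ZMod t) where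
  step s _ := s + 1
  start := 0
  accept := {0}

theorem cyclicDFA_eval_replicate (t m : ℕ) :
    (cyclicDFA t).eval (List.replicate m ()) = (m : ZMod t) := by
  induction m with
  | zero => simp [cyclicDFA]
  | succ m ih =>
    rw [List.replicate_succ', DFA.eval_append_singleton, ih]
    simp [cyclicDFA]

theorem replicate_mem_cyclicDFA_accepts (t m : ℕ) :
    List.replicate m () ∈ (cyclicDFA t).accepts ↔ t ∣ m := by
  rw [DFA.mem_accepts, cyclicDFA_eval_replicate, ← ZMod.natCast_eq_zero_iff]
  rfl

/-- The cyclic DFA on `ZMod t` with `t = p_n · p_{n+1} ⋯ p_{n+⌊k/3⌋+1}` states solves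
`L^{k,n}`: multiples of `N` are accepted and no-instances are rejected. Equivalently,
`N ∣ m` implies `t ∣ m`, and `t ∣ m` implies `m` is not a no-instance. -/
theorem dfa_state_upper_bound_Lkn (n k : ℕ) (hn : 1 ≤ n) (hk : 3 ≤ k) :
    (∃ M : DFA Unit (ZMod (∏ j ∈ Finset.Icc n (n + k / 3 + 1), nthPrime j)),
      (∀ m : ℕ, Nprod n k ∣ m → List.replicate m () ∈ M.accepts) ∧
      (∀ m ∈ Lno n k, List.replicate m () ∉ M.accepts)) ∧
    (∀ m : ℕ, Nprod n k ∣ m → (∏ j ∈ Finset.Icc n (n + k / 3 + 1), nthPrime j) ∣ m) ∧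
    (∀ m : ℕ, (∏ j ∈ Finset.Icc n (n + k / 3 + 1), nthPrime j) ∣ m →
      (noCount n k m : ℝ) < 2 * k / 3) := by
  have hs : Finset.Icc n (n + k / 3 + 1) ⊆ Finset.Ico n (n + k) := by
    intro j hj
    rw [Finset.mem_Icc] at hj
    rw [Finset.mem_Ico]
    omega
  have hyes : ∀ m : ℕ, Nprod n k ∣ m →
      (∏ j ∈ Finset.Icc n (n + k / 3 + 1), nthPrime j) ∣ m :=
    fun m hm => (Finset.prod_dvd_prod_of_subset _ _ _ hs).trans hm
  have hno : ∀ m : ℕ, (∏ j ∈ Finset.Icc n (n + k / 3 + 1), nthPrime j) ∣ m →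
      (noCount n k m : ℝ) < 2 * k / 3 := by
    intro m hm
    have hcount := noCount_add_card_le hs hm
    rw [Nat.card_Icc] at hcount
    have hlt : 3 * noCount n k m < 2 * k := by omega
    have hlt' : (3 : ℝ) * noCount n k m < 2 * k := by exact_mod_cast hlt
    linarith
  refine ⟨⟨cyclicDFA _, fun m hm => ?_, fun m hm hacc => ?_⟩, hyes, hno⟩
  · exact (replicate_mem_cyclicDFA_accepts _ m).2 (hyes m hm)
  · exact (hno m ((replicate_mem_cyclicDFA_accepts _ m).1 hacc)).not_ge hm
end
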